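/- Let f : ℝ^M → ℝ be twice continuously differentiable. For fixed baseline x⁰ ∈ ℝ^M, the map x ↦ IG_i(x | x⁰) is differentiable in x_i, with ∂IG_i(x | x⁰)/∂x_i = ∫₀¹ (∂f/∂x_i)(x⁰ + α(x − x⁰)) dα + (x_i − x_i⁰) ∫₀¹ α (∂²f/∂x_i²)(x⁰ + α(x − x⁰)) dα, and for every x^t ∈ ℝ^M and every i, the limit as x⁰ → x^t of ∂IG_i(x^t | x⁰)/∂x_i equals (∂f/∂x_i)(x^t), which is the LIME attribution score LIME⁰_i(x^t) in the vanishing-regularization limit. -/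

import Mathlib

open Filter Topology

theorem ig_param {M : ℕ} (g : (Fin M → ℝ) → ℝ) (hg : ContDiff ℝ 1 g) (i : Fin M)
    (x0 x : Fin M → ℝ) :
    HasDerivAt (fun t : ℝ => ∫ α in (0:ℝ)..1, g (x0 + α • (Function.update x i t - x0)))
      (∫ α in (0:ℝ)..1, α * fderiv ℝ g (x0 + α • (x - x0)) (Pi.single i 1)) (x i) := by
  have hc : Continuous g := hg.continuous
  have hd : Continuous (fderiv ℝ g) := hg.continuous_fderiv (by norm_num)
  let F' : ℝ → ℝ → ℝ := fun t α =>
    α * fderiv ℝ g (x0 + α • (Function.update x i t - x0)) (Pi.single i 1)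
  have hu : Continuous (fun t : ℝ => Function.update x i t) :=
    continuous_const.update i continuous_id
  have hF' : Continuous (fun p : ℝ × ℝ => F' p.1 p.2) := by
    have h1 : Continuous (fun p : ℝ × ℝ => Function.update x i p.1) := hu.comp continuous_fst
    have h2 : Continuous (fun p : ℝ × ℝ => x0 + p.2 • (Function.update x i p.1 - x0)) := by
      fun_prop
    exact continuous_snd.mul ((hd.comp h2).clm_apply continuous_const)
  obtain ⟨C, hC⟩ := ((isCompact_Icc (a := x i - 1) (b := x i + 1)).prod
    (isCompact_Icc (a := (0:ℝ)) (b := 1))).exists_bound_of_continuousOn hF'.continuousOn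
  have hFc : ∀ t : ℝ, Continuous
      (fun α : ℝ => g (x0 + α • (Function.update x i t - x0))) := fun t => by fun_prop
  have key := (intervalIntegral.hasDerivAt_integral_of_dominated_loc_of_deriv_le
    (μ := MeasureTheory.volume) (a := 0) (b := 1) (𝕜 := ℝ)
    (F := fun t α => g (x0 + α • (Function.update x i t - x0))) (F' := F') (x₀ := x i)
    (s := Set.Icc (x i - 1) (x i + 1)) (bound := fun _ => C)
    (Icc_mem_nhds (by linarith) (by linarith))
    (Eventually.of_forall fun t => (hFc t).aestronglyMeasurable)
    ((hFc _).intervalIntegrable _ _)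
    (by
      have : Continuous (F' (x i)) := hF'.comp (Continuous.prodMk_right (x i))
      exact this.aestronglyMeasurable)
    (Eventually.of_forall fun α hα t ht => by
      rw [Set.uIoc_of_le zero_le_one] at hα
      exact hC (t, α) ⟨ht, hα.1.le, hα.2⟩)
    (by simp)
    (Eventually.of_forall fun α hα t ht => by
      have h1 : HasDerivAt (fun t : ℝ => x0 + α • (Function.update x i t - x0))
          (α • (Pi.single i 1 : Fin M → ℝ)) t :=
        (((hasDerivAt_update x i t).sub_const x0).const_smul α).const_add x0
      have h2 := ((hg.differentiable (by norm_num)) _).hasFDerivAt.comp_hasDerivAt t h1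
      simpa [F', Function.comp_def] using h2)).2
  simpa [F'] using key

theorem ig_main {M : ℕ} (g : (Fin M → ℝ) → ℝ) (hg : ContDiff ℝ 1 g) (i : Fin M) :
    (∀ x0 x : Fin M → ℝ,
      HasDerivAt
        (fun t : ℝ => (t - x0 i) *
          ∫ α in (0:ℝ)..1, g (x0 + α • (Function.update x i t - x0)))
        ((∫ α in (0:ℝ)..1, g (x0 + α • (x - x0))) +
          (x i - x0 i) *
            ∫ α in (0:ℝ)..1, α * fderiv ℝ g (x0 + α • (x - x0)) (Pi.single i 1))
        (x i)) ∧
    (∀ xt : Fin M → ℝ,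
      Tendsto
        (fun x0 : Fin M → ℝ =>
          (∫ α in (0:ℝ)..1, g (x0 + α • (xt - x0))) +
            (xt i - x0 i) *
              ∫ α in (0:ℝ)..1, α * fderiv ℝ g (x0 + α • (xt - x0)) (Pi.single i 1))
        (𝓝 xt) (𝓝 (g xt))) := by
  have hc : Continuous g := hg.continuous
  have hd : Continuous (fderiv ℝ g) := hg.continuous_fderiv (by norm_num)
  refine ⟨fun x0 x => ?_, fun xt => ?_⟩
  · have h := ((hasDerivAt_id (x i)).sub_const (x0 i)).mul (ig_param g hg i x0 x)
    simp only [Function.update_eq_self, one_mul, id] at h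
    exact h
  · have h2 : Continuous (fun p : (Fin M → ℝ) × ℝ => p.1 + p.2 • (xt - p.1)) := by fun_prop
    have c1 : Continuous (fun x0 : Fin M → ℝ => ∫ α in (0:ℝ)..1, g (x0 + α • (xt - x0))) :=
      intervalIntegral.continuous_parametric_intervalIntegral_of_continuous'
        (f := fun x0 α => g (x0 + α • (xt - x0))) (hc.comp h2) 0 1
    have c2 : Continuous (fun x0 : Fin M → ℝ =>
        ∫ α in (0:ℝ)..1, α * fderiv ℝ g (x0 + α • (xt - x0)) (Pi.single i 1)) :=
      intervalIntegral.continuous_parametric_intervalIntegral_of_continuous'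
        (continuous_snd.mul ((hd.comp h2).clm_apply continuous_const)) 0 1
    have c3 : Continuous (fun x0 : Fin M → ℝ => xt i - x0 i) := by fun_prop
    have h := (c1.add (c3.mul c2)).tendsto xt
    simp only [Pi.add_apply, Pi.mul_apply, sub_self, smul_zero, add_zero, zero_mul,
      intervalIntegral.integral_const, sub_zero, one_smul] at h
    exact h

/-- For a twice continuously differentiable `f`, the map `x ↦ IGᵢ(x | x⁰)` is
differentiable in the coordinate `xᵢ`, with derivative
`∫₀¹ ∂ᵢf(x⁰+α(x−x⁰)) dα + (xᵢ−xᵢ⁰) ∫₀¹ α ∂ᵢ²f(x⁰+α(x−x⁰)) dα`, and as the baseline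
`x⁰ → xᵗ` this derivative tends to `∂ᵢf(xᵗ)`, the LIME attribution score
`LIME⁰ᵢ(xᵗ)` in the vanishing-regularization limit. -/
theorem stmt_8 (M : ℕ) (f : (Fin M → ℝ) → ℝ) (hf : ContDiff ℝ 2 f) (i : Fin M) :
    (∀ x0 x : Fin M → ℝ,
      HasDerivAt
        (fun t : ℝ => (t - x0 i) *
          ∫ α in (0:ℝ)..1,
            fderiv ℝ f (x0 + α • (Function.update x i t - x0)) (Pi.single i 1))
        ((∫ α in (0:ℝ)..1, fderiv ℝ f (x0 + α • (x - x0)) (Pi.single i 1)) +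
          (x i - x0 i) *
            ∫ α in (0:ℝ)..1,
              α * fderiv ℝ (fun y => fderiv ℝ f y (Pi.single i 1)) (x0 + α • (x - x0))
                (Pi.single i 1))
        (x i)) ∧
    (∀ xt : Fin M → ℝ,
      Tendsto
        (fun x0 : Fin M → ℝ =>
          (∫ α in (0:ℝ)..1, fderiv ℝ f (x0 + α • (xt - x0)) (Pi.single i 1)) +
            (xt i - x0 i) *
              ∫ α in (0:ℝ)..1,
                α * fderiv ℝ (fun y => fderiv ℝ f y (Pi.single i 1)) (x0 + α • (xt - x0))
                  (Pi.single i 1))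
        (𝓝 xt) (𝓝 (fderiv ℝ f xt (Pi.single i 1)))) := by
  exact ig_main (fun y => fderiv ℝ f y (Pi.single i 1))
    ((hf.fderiv_right (m := 1) (by norm_num)).clm_apply contDiff_const) i
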